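/- For i = 1, 2, let λᵢ > 0, αᵢ ∈ ℝ, Cᵢ ≠ 0, and define bᵢ(λ) = λᵢ − λ + λ·log(λ/λᵢ) + (Cᵢ²/2)·(λ − αᵢ)² with derivative bᵢ'(λ) = Cᵢ²·(λ − αᵢ) + log(λ/λᵢ) for λ > 0. Then the system of equations (λ₁* + λ₂*)·b₁'(λ₁*) + b₂(λ₂*) − b₁(λ₁*) = 0 and (λ₁* + λ₂*)·b₂'(λ₂*) + b₁(λ₁*) − b₂(λ₂*) = 0 has exactly one solution (λ₁*, λ₂*) with λ₁* > 0 and λ₂* > 0. -/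

import Mathlib

theorem aux_core (a c l m α β d : ℝ) (ha : 0 < a) (hc : 0 < c) (hl : 0 < l) (hm : 0 < m)
    (hd : 0 ≤ d) : ∃ x y : ℝ, 0 < x ∧ 0 < y ∧
      (a * (x - α) + Real.log (x / l)) + (c * (y - β) + Real.log (y / m)) = 0 ∧
      x + a / 2 * x ^ 2 + d = y + c / 2 * y ^ 2 := by
  obtain ⟨Y, hY⟩ : ∃ Y : ℝ → ℝ, Y = fun x =>
    (Real.sqrt (1 + 2 * c * (x + a / 2 * x ^ 2 + d)) - 1) / c := ⟨_, rfl⟩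
  have hYc : Continuous Y := by rw [hY]; fun_prop
  have hpos : ∀ x, 0 < x → 0 < Y x := by
    intro x hx
    rw [hY]
    apply div_pos _ hc
    have : 0 < 2 * c * (x + a / 2 * x ^ 2 + d) := by positivity
    have := Real.lt_sqrt_of_sq_lt (x := 1) (y := 1 + 2 * c * (x + a / 2 * x ^ 2 + d)) (by linarith)
    linarith
  have hmono : ∀ x z, 0 < x → x ≤ z → Y x ≤ Y z := by
    intro x z hx hxz
    rw [hY]
    dsimp only
    gcongr
  have heq : ∀ x, 0 < x → x + a / 2 * x ^ 2 + d = Y x + c / 2 * (Y x) ^ 2 := by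
    intro x hx
    have h := Real.sq_sqrt (show 0 ≤ 1 + 2 * c * (x + a / 2 * x ^ 2 + d) by positivity)
    rw [hY]
    dsimp only
    generalize Real.sqrt (1 + 2 * c * (x + a / 2 * x ^ 2 + d)) = s at h
    field_simp
    nlinarith
  obtain ⟨B, hB⟩ : ∃ B : ℝ → ℝ, B = fun y => c * (y - β) + Real.log (y / m) := ⟨_, rfl⟩
  have hBm : ∀ x z, 0 < x → x ≤ z → B (Y x) ≤ B (Y z) := by
    intro x z hx hxz
    have h1 := hpos x hx
    have h2 := hmono x z hx hxz
    rw [hB]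
    dsimp only
    have : Real.log (Y x / m) ≤ Real.log (Y z / m) := Real.log_le_log (by positivity) (by gcongr)
    nlinarith
  -- small point
  obtain ⟨u, hu0, hu1, hu⟩ : ∃ u, 0 < u ∧ u ≤ 1 ∧
      a * (u - α) + Real.log (u / l) + B (Y 1) ≤ 0 := by
    refine ⟨min 1 (l * Real.exp (-(a * (1 - α) + B (Y 1)))), by positivity, min_le_left _ _, ?_⟩
    set u := min 1 (l * Real.exp (-(a * (1 - α) + B (Y 1)))) with hu
    have h0 : 0 < u := by positivity
    have h1 : u ≤ 1 := min_le_left _ _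
    have h2 : u / l ≤ Real.exp (-(a * (1 - α) + B (Y 1))) := by
      rw [div_le_iff₀ hl, mul_comm]; exact min_le_right _ _
    have h3 := (Real.log_le_iff_le_exp (by positivity)).2 h2
    nlinarith
  obtain ⟨v, hv1, hv⟩ : ∃ v, 1 ≤ v ∧
      0 ≤ a * (v - α) + Real.log (v / l) + B (Y 1) := by
    refine ⟨max 1 (l * Real.exp (-(a * (1 - α) + B (Y 1)))), le_max_left _ _, ?_⟩
    set u := max 1 (l * Real.exp (-(a * (1 - α) + B (Y 1)))) with hu
    have h1 : 1 ≤ u := le_max_left _ _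
    have h2 : Real.exp (-(a * (1 - α) + B (Y 1))) ≤ u / l := by
      rw [le_div_iff₀ hl, mul_comm]; exact le_max_right _ _
    have h3 := (Real.le_log_iff_exp_le (by positivity)).2 h2
    nlinarith
  have hcont : ContinuousOn (fun x => a * (x - α) + Real.log (x / l) + B (Y x)) (Set.Icc u v) := by
    rw [hB]
    apply ContinuousOn.add
    · apply ContinuousOn.add (by fun_prop)
      apply ContinuousOn.log (by fun_prop)
      intro x hx
      have : 0 < x := lt_of_lt_of_le hu0 hx.1
      positivity
    · apply ContinuousOn.add (by fun_prop)
      apply ContinuousOn.log (by fun_prop)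
      intro x hx
      have := hpos x (lt_of_lt_of_le hu0 hx.1)
      positivity
  obtain ⟨x, hx, hx0⟩ := intermediate_value_Icc (hu1.trans hv1) hcont
    (show (0:ℝ) ∈ Set.Icc _ _ from
      ⟨by have := hBm u 1 hu0 hu1; linarith,
       by have := hBm 1 v one_pos hv1; linarith⟩)
  have hxp : 0 < x := lt_of_lt_of_le hu0 hx.1
  refine ⟨x, Y x, hxp, hpos x hxp, ?_, heq x hxp⟩
  rw [hB] at hx0
  exact hx0

theorem aux_ex (a c l m α β K L : ℝ) (ha : 0 < a) (hc : 0 < c) (hl : 0 < l) (hm : 0 < m) :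
    ∃ x y : ℝ, 0 < x ∧ 0 < y ∧
      (a * (x - α) + Real.log (x / l)) + (c * (y - β) + Real.log (y / m)) = 0 ∧
      K - x - a / 2 * x ^ 2 = L - y - c / 2 * y ^ 2 := by
  rcases le_total K L with h | h
  · obtain ⟨x, y, hx, hy, h1, h2⟩ := aux_core a c l m α β (L - K) ha hc hl hm (by linarith)
    exact ⟨x, y, hx, hy, h1, by linarith⟩
  · obtain ⟨x, y, hx, hy, h1, h2⟩ := aux_core c a m l β α (K - L) hc ha hm hl (by linarith)
    exact ⟨y, x, hy, hx, by linarith, by linarith⟩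

theorem aux_lt (a c l m α β K L : ℝ) (ha : 0 < a) (hc : 0 < c) (hl : 0 < l) (hm : 0 < m)
    (x y x' y' : ℝ) (hx : 0 < x) (hy : 0 < y) (hy' : 0 < y')
    (h1 : (a * (x - α) + Real.log (x / l)) + (c * (y - β) + Real.log (y / m)) = 0)
    (h2 : K - x - a / 2 * x ^ 2 = L - y - c / 2 * y ^ 2)
    (h1' : (a * (x' - α) + Real.log (x' / l)) + (c * (y' - β) + Real.log (y' / m)) = 0)
    (h2' : K - x' - a / 2 * x' ^ 2 = L - y' - c / 2 * y' ^ 2) : ¬ x < x' := by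
  intro h
  have hq : a / 2 * x ^ 2 ≤ a / 2 * x' ^ 2 := by gcongr
  have hyy : y < y' := by
    by_contra! hn
    have : c / 2 * y' ^ 2 ≤ c / 2 * y ^ 2 := by gcongr
    linarith
  have e1 : Real.log (x / l) < Real.log (x' / l) := Real.log_lt_log (by positivity) (by gcongr)
  have e2 : Real.log (y / m) < Real.log (y' / m) := Real.log_lt_log (by positivity) (by gcongr)
  nlinarith


/-- The critical-point system of the long-term minimal entropy martingale measure
problem for a two-state regime-switching jump-diffusion has exactly one solution
`(λ₁*, λ₂*)` with positive components. -/
theorem stmt11 (l1 l2 α1 α2 C1 C2 : ℝ)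
    (hl1 : 0 < l1) (hl2 : 0 < l2) (hC1 : C1 ≠ 0) (hC2 : C2 ≠ 0)
    (b1 b2 b1' b2' : ℝ → ℝ)
    (hb1 : ∀ l, b1 l = l1 - l + l * Real.log (l / l1) + C1 ^ 2 / 2 * (l - α1) ^ 2)
    (hb2 : ∀ l, b2 l = l2 - l + l * Real.log (l / l2) + C2 ^ 2 / 2 * (l - α2) ^ 2)
    (hb1' : ∀ l, b1' l = C1 ^ 2 * (l - α1) + Real.log (l / l1))
    (hb2' : ∀ l, b2' l = C2 ^ 2 * (l - α2) + Real.log (l / l2)) :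
    ∃! p : ℝ × ℝ, 0 < p.1 ∧ 0 < p.2 ∧
      (p.1 + p.2) * b1' p.1 + b2 p.2 - b1 p.1 = 0 ∧
      (p.1 + p.2) * b2' p.2 + b1 p.1 - b2 p.2 = 0 := by
  have ha : 0 < C1 ^ 2 := by positivity
  have hc : 0 < C2 ^ 2 := by positivity
  have key : ∀ x y : ℝ, 0 < x → 0 < y →
      (((x + y) * b1' x + b2 y - b1 x = 0 ∧ (x + y) * b2' y + b1 x - b2 y = 0) ↔
      ((C1 ^ 2 * (x - α1) + Real.log (x / l1)) + (C2 ^ 2 * (y - α2) + Real.log (y / l2)) = 0 ∧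
      (l1 + C1 ^ 2 / 2 * α1 ^ 2) - x - C1 ^ 2 / 2 * x ^ 2
        = (l2 + C2 ^ 2 / 2 * α2 ^ 2) - y - C2 ^ 2 / 2 * y ^ 2)) := by
    intro x y hx hy
    rw [hb1, hb2, hb1', hb2']
    generalize Real.log (x / l1) = P
    generalize Real.log (y / l2) = Q
    constructor
    · rintro ⟨h1, h2⟩
      have h3 : (C1 ^ 2 * (x - α1) + P) + (C2 ^ 2 * (y - α2) + Q) = 0 := by
        have : (x + y) * ((C1 ^ 2 * (x - α1) + P) + (C2 ^ 2 * (y - α2) + Q)) = 0 := by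
          linarith
        exact (mul_eq_zero.1 this).resolve_left (by positivity)
      exact ⟨h3, by linear_combination y * h3 - h1⟩
    · rintro ⟨h3, h4⟩
      exact ⟨by linear_combination y * h3 - h4, by linear_combination x * h3 + h4⟩
  obtain ⟨x, y, hx, hy, h1, h2⟩ := aux_ex (C1 ^ 2) (C2 ^ 2) l1 l2 α1 α2
    (l1 + C1 ^ 2 / 2 * α1 ^ 2) (l2 + C2 ^ 2 / 2 * α2 ^ 2) ha hc hl1 hl2
  refine ⟨(x, y), ⟨hx, hy, (key x y hx hy).2 ⟨h1, h2⟩⟩, ?_⟩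
  rintro ⟨x', y'⟩ ⟨hx', hy', h'⟩
  dsimp only at hx' hy' h'
  obtain ⟨h1', h2'⟩ := (key x' y' hx' hy').1 h'
  have hxx : x' = x := le_antisymm
    (not_lt.1 (aux_lt _ _ _ _ _ _ _ _ ha hc hl1 hl2 x y x' y' hx hy hy' h1 h2 h1' h2'))
    (not_lt.1 (aux_lt _ _ _ _ _ _ _ _ ha hc hl1 hl2 x' y' x y hx' hy' hy h1' h2' h1 h2))
  have hyy : y' = y := le_antisymm
    (not_lt.1 (aux_lt _ _ _ _ α2 α1 _ _ hc ha hl2 hl1 y x y' x' hy hx hx'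
      (by linarith) h2.symm (by linarith) h2'.symm))
    (not_lt.1 (aux_lt _ _ _ _ α2 α1 _ _ hc ha hl2 hl1 y' x' y x hy' hx' hx
      (by linarith) h2'.symm (by linarith) h2.symm))
  rw [hxx, hyy]
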